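/- Let L, L_r, L_s, Σ, Q be a normed continuous-time Markov game structure, fix t ∈ ℝ and 0 < ε ≤ 1, and let x : L → ℝ satisfy x(l) ∈ [0,1] for all l. Let f : L → ℝ → ℝ solve the Bellman equations on [t−ε, t] with terminal value x and take values in [0,1] on [t−ε,t]. Let p1 be a single ε-net approximation from x with chosen actions a_l, and let g1 : L → ℝ → ℝ satisfy g1(l,t) = x(l), take values in [0,1] on [t−ε,t], and for every τ ∈ [t−ε,t]: for l ∈ L_r the derivative of g1(l,·) at τ equals −Σ_{l'} Q(l,a_l,l')·g1(l',τ), and for l ∈ L_s it equals −min over a ∈ Σ(l) of Σ_{l'} Q(l,a,l')·g1(l',τ). Then ‖g1(·, t−ε) − f(·, t−ε)‖ ≤ 2·ε², where ‖·‖ is the sup-norm over locations. -/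

import Mathlib

/-- A normed continuous-time Markov game structure: a finite nonempty set `L` of
locations partitioned into reachability locations (`isReach l = true`) and safety
locations (`isReach l = false`), a finite set `A` of actions with a nonempty set
`enabled l` of enabled actions at each location, and a rate matrix `R` whose rows
(for enabled actions) are probability distributions on `L`. -/
structure NCTMG (L A : Type) [Fintype L] [DecidableEq L] [Fintype A] where
  isReach : L → Bool
  enabled : L → Finset A
  enabled_nonempty : ∀ l, (enabled l).Nonempty
  R : L → A → L → ℝ
  R_nonneg : ∀ l a l', a ∈ enabled l → 0 ≤ R l a l'
  R_sum : ∀ l a, a ∈ enabled l → (∑ l', R l a l') = 1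

namespace NCTMG

variable {L A : Type} [Fintype L] [DecidableEq L] [Fintype A]

/-- The generator `Q(l,a,l') = R(l,a,l') − δ_{l,l'}`. -/
def Q (M : NCTMG L A) (l : L) (a : A) (l' : L) : ℝ :=
  M.R l a l' - (if l = l' then 1 else 0)

/-- `opt_l`: maximum over enabled actions at reachability locations, minimum
over enabled actions at safety locations. -/
noncomputable def opt (M : NCTMG L A) (l : L) (v : A → ℝ) : ℝ :=
  if M.isReach l then (M.enabled l).sup' (M.enabled_nonempty l) v
  else (M.enabled l).inf' (M.enabled_nonempty l) v

/-- `f` solves the Bellman equations on `[t−ε, t]` with terminal value `x`. -/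
def SolvesBellman (M : NCTMG L A) (t ε : ℝ) (x : L → ℝ) (f : L → ℝ → ℝ) : Prop :=
  (∀ l, f l t = x l) ∧
  ∀ l, ∀ τ ∈ Set.Icc (t - ε) t,
    HasDerivAt (f l) (-(M.opt l (fun a => ∑ l', M.Q l a l' * f l' τ))) τ

/-- `p1` is a single `ε`-net approximation from terminal value `x` with chosen
actions `act`: each `act l` is enabled and attains `opt_l` of `∑ Q(l,a,·)·x`,
and `p1(l, t−τ) = x(l) + τ·c_l` on `[0,ε]` where `c_l = ∑ Q(l,act l,·)·x`. -/
def IsSingleNet (M : NCTMG L A) (t ε : ℝ) (x : L → ℝ) (act : L → A)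
    (p1 : L → ℝ → ℝ) : Prop :=
  (∀ l, act l ∈ M.enabled l) ∧
  (∀ l, (∑ l', M.Q l (act l) l' * x l') =
      M.opt l (fun a => ∑ l', M.Q l a l' * x l')) ∧
  (∀ l, ∀ τ ∈ Set.Icc (0 : ℝ) ε,
      p1 l (t - τ) = x l + τ * (∑ l', M.Q l (act l) l' * x l'))

end NCTMG

/-- The sup-norm `‖v‖ = max_{l∈L} |v l|` on functions `L → ℝ`. -/
noncomputable def supNorm {L : Type} [Fintype L] [Nonempty L] (v : L → ℝ) : ℝ :=
  Finset.univ.sup' Finset.univ_nonempty (fun l => |v l|)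


/-- The supremum over a nonempty finite set is nonexpansive. -/
theorem Finset.abs_sup'_sub_sup'_le {α : Type*} (s : Finset α) (hs : s.Nonempty)
    {v w : α → ℝ} {K : ℝ} (h : ∀ a ∈ s, |v a - w a| ≤ K) :
    |s.sup' hs v - s.sup' hs w| ≤ K := by
  rw [abs_sub_le_iff, sub_le_iff_le_add, sub_le_iff_le_add]
  constructor <;> refine Finset.sup'_le hs _ fun a ha => ?_
  · linarith [(abs_le.1 (h a ha)).2, Finset.le_sup' w ha]
  · linarith [(abs_le.1 (h a ha)).1, Finset.le_sup' v ha]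

/-- The infimum over a nonempty finite set is nonexpansive. -/
theorem Finset.abs_inf'_sub_inf'_le {α : Type*} (s : Finset α) (hs : s.Nonempty)
    {v w : α → ℝ} {K : ℝ} (h : ∀ a ∈ s, |v a - w a| ≤ K) :
    |s.inf' hs v - s.inf' hs w| ≤ K := by
  rw [abs_sub_le_iff, sub_le_comm, sub_le_comm (b := s.inf' hs v)]
  constructor <;> refine Finset.le_inf' hs _ fun a ha => ?_
  · linarith [(abs_le.1 (h a ha)).2, Finset.inf'_le v ha]
  · linarith [(abs_le.1 (h a ha)).1, Finset.inf'_le w ha]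

theorem Finset.abs_sup'_le_and_abs_inf'_le {α : Type*} (s : Finset α) (hs : s.Nonempty)
    {v : α → ℝ} {K : ℝ} (h : ∀ a ∈ s, |v a| ≤ K) :
    |s.sup' hs v| ≤ K ∧ |s.inf' hs v| ≤ K := by
  have h0 : ∀ a ∈ s, |v a - (fun _ => (0 : ℝ)) a| ≤ K := by simpa using h
  constructor
  · simpa using s.abs_sup'_sub_sup'_le hs h0
  · simpa using s.abs_inf'_sub_inf'_le hs h0

namespace NCTMG

variable {L A : Type} [Fintype L] [DecidableEq L] [Fintype A]

theorem sum_Q_mul (M : NCTMG L A) (l : L) (a : A) (v : L → ℝ) :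
    ∑ l', M.Q l a l' * v l' = ∑ l', M.R l a l' * v l' - v l := by
  simp [Q, sub_mul, Finset.sum_sub_distrib]

theorem abs_sum_R_mul_le (M : NCTMG L A) {l : L} {a : A} (ha : a ∈ M.enabled l)
    {v : L → ℝ} {K : ℝ} (hv : ∀ l', |v l'| ≤ K) : |∑ l', M.R l a l' * v l'| ≤ K := by
  calc |∑ l', M.R l a l' * v l'| ≤ ∑ l', |M.R l a l' * v l'| :=
        Finset.abs_sum_le_sum_abs _ _
    _ ≤ ∑ l', M.R l a l' * K := Finset.sum_le_sum fun l' _ => by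
        rw [abs_mul, abs_of_nonneg (M.R_nonneg l a l' ha)]
        exact mul_le_mul_of_nonneg_left (hv l') (M.R_nonneg l a l' ha)
    _ = K := by rw [← Finset.sum_mul, M.R_sum l a ha, one_mul]

theorem abs_sum_Q_mul_sub_le (M : NCTMG L A) {l : L} {a : A} (ha : a ∈ M.enabled l)
    {v w : L → ℝ} {K : ℝ} (h : ∀ l', |v l' - w l'| ≤ K) :
    |∑ l', M.Q l a l' * v l' - ∑ l', M.Q l a l' * w l'| ≤ 2 * K := by
  have hR := M.abs_sum_R_mul_le ha h
  have hl := h l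
  simp only [mul_sub, Finset.sum_sub_distrib] at hR
  rw [M.sum_Q_mul, M.sum_Q_mul]
  rw [abs_le] at *
  constructor <;> linarith

theorem abs_sum_Q_mul_le_one (M : NCTMG L A) {l : L} {a : A} (ha : a ∈ M.enabled l)
    {v : L → ℝ} (hv : ∀ l', v l' ∈ Set.Icc (0 : ℝ) 1) :
    |∑ l', M.Q l a l' * v l'| ≤ 1 := by
  have h1 := M.abs_sum_R_mul_le ha (v := v) (K := 1) fun l' => by
    rw [abs_of_nonneg (hv l').1]
    exact (hv l').2
  have h0 : 0 ≤ ∑ l', M.R l a l' * v l' :=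
    Finset.sum_nonneg fun l' _ => mul_nonneg (M.R_nonneg l a l' ha) (hv l').1
  rw [M.sum_Q_mul, abs_le]
  have := hv l
  rw [abs_le] at h1
  constructor <;> linarith [this.1, this.2]

/-- A one-step operator at each location that is `2`-Lipschitz for the sup-norm and maps
`[0,1]`-valued functions to `[-1,1]`. -/
structure IsStepOperator (D : L → (L → ℝ) → ℝ) : Prop where
  abs_sub_le : ∀ l (v w : L → ℝ) (K : ℝ), (∀ l', |v l' - w l'| ≤ K) →
    |D l v - D l w| ≤ 2 * K
  abs_le_one : ∀ l (v : L → ℝ), (∀ l', v l' ∈ Set.Icc (0 : ℝ) 1) → |D l v| ≤ 1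

theorem isStepOperator_opt (M : NCTMG L A) :
    IsStepOperator fun l v => M.opt l fun a => ∑ l', M.Q l a l' * v l' where
  abs_sub_le l v w K h := by
    have hQ : ∀ a ∈ M.enabled l, _ := fun a ha => M.abs_sum_Q_mul_sub_le ha h
    unfold opt
    split_ifs
    · exact Finset.abs_sup'_sub_sup'_le _ _ hQ
    · exact Finset.abs_inf'_sub_inf'_le _ _ hQ
  abs_le_one l v hv := by
    have hQ := Finset.abs_sup'_le_and_abs_inf'_le _ (M.enabled_nonempty l)
      fun a ha => M.abs_sum_Q_mul_le_one ha hv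
    unfold opt
    split_ifs
    · exact hQ.1
    · exact hQ.2

/-- The step operator when the reachability player plays the fixed actions `act` and the
safety player plays optimally. -/
noncomputable def fixedReachStep (M : NCTMG L A) (act : L → A) (l : L) (v : L → ℝ) : ℝ :=
  if M.isReach l then ∑ l', M.Q l (act l) l' * v l'
  else (M.enabled l).inf' (M.enabled_nonempty l) fun a => ∑ l', M.Q l a l' * v l'

theorem isStepOperator_fixedReachStep (M : NCTMG L A) {act : L → A}
    (hact : ∀ l, act l ∈ M.enabled l) : IsStepOperator (M.fixedReachStep act) where
  abs_sub_le l v w K h := by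
    unfold fixedReachStep
    split_ifs
    · exact M.abs_sum_Q_mul_sub_le (hact l) h
    · exact Finset.abs_inf'_sub_inf'_le _ _ fun a ha => M.abs_sum_Q_mul_sub_le ha h
  abs_le_one l v hv := by
    unfold fixedReachStep
    split_ifs
    · exact M.abs_sum_Q_mul_le_one (hact l) hv
    · exact (Finset.abs_sup'_le_and_abs_inf'_le _ (M.enabled_nonempty l)
        fun a ha => M.abs_sum_Q_mul_le_one ha hv).2

theorem fixedReachStep_eq_opt (M : NCTMG L A) {act : L → A} {l : L} {v : L → ℝ}
    (h : ∑ l', M.Q l (act l) l' * v l' = M.opt l fun a => ∑ l', M.Q l a l' * v l') :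
    M.fixedReachStep act l v = M.opt l fun a => ∑ l', M.Q l a l' * v l' := by
  unfold fixedReachStep
  split_ifs with hl
  · exact h
  · simp [opt, hl]

/-- A solution of `u' = -D u` is approximated by its backward Euler line up to `s ^ 2`. -/
theorem IsStepOperator.abs_sub_euler_le {D : L → (L → ℝ) → ℝ} (hD : IsStepOperator D)
    {t ε : ℝ} {u : L → ℝ → ℝ}
    (hu : ∀ l, ∀ τ ∈ Set.Icc (t - ε) t, u l τ ∈ Set.Icc (0 : ℝ) 1)
    (hu' : ∀ l, ∀ τ ∈ Set.Icc (t - ε) t, HasDerivAt (u l) (-D l fun l' => u l' τ) τ)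
    (l : L) {s : ℝ} (hs : s ∈ Set.Icc 0 ε) :
    |u l (t - s) - (u l t + s * D l fun l' => u l' t)| ≤ s ^ 2 := by
  have hmem : ∀ s ∈ Set.Icc 0 ε, t - s ∈ Set.Icc (t - ε) t := fun s hs =>
    ⟨by linarith [hs.2], by linarith [hs.1]⟩
  have hderiv : ∀ l, ∀ s ∈ Set.Icc 0 ε,
      HasDerivAt (fun r => u l (t - r)) (D l fun l' => u l' (t - s)) s := fun l s hs => by
    simpa [Function.comp_def] using (hu' l _ (hmem s hs)).scomp s ((hasDerivAt_id s).const_sub t)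
  have hdrift : ∀ l, ∀ s ∈ Set.Icc 0 ε, |u l (t - s) - u l t| ≤ s := fun l s hs => by
    simpa using norm_image_sub_le_of_norm_deriv_le_segment' (C := 1)
      (fun r hr => (hderiv l r hr).hasDerivWithinAt)
      (fun r hr => hD.abs_le_one l _ fun l' => hu l' _ (hmem r (Set.Ico_subset_Icc_self hr)))
      s hs
  have herr : ∀ s ∈ Set.Icc 0 ε,
      HasDerivAt (fun r => u l (t - r) - (u l t + r * D l fun l' => u l' t))
        ((D l fun l' => u l' (t - s)) - D l fun l' => u l' t) s := fun s hs => by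
    simpa [Pi.sub_def] using (hderiv l s hs).sub
      (((hasDerivAt_id s).mul_const (D l fun l' => u l' t)).const_add (u l t))
  exact image_norm_le_of_norm_deriv_right_le_deriv_boundary (B := fun r => r ^ 2)
    (B' := fun r => 2 * r)
    (fun r hr => (herr r hr).continuousAt.continuousWithinAt)
    (fun r hr => (herr r (Set.Ico_subset_Icc_self hr)).hasDerivWithinAt)
    (by simp) (fun r => by simpa using hasDerivAt_pow 2 r)
    (fun r hr => hD.abs_sub_le l _ _ r fun l' => hdrift l' r (Set.Ico_subset_Icc_self hr)) hs

end NCTMG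

/-- the value `g1` obtained when the reachability player plays the
fixed single-net actions throughout `[t−ε,t]` (against an optimally playing
safety player) differs from the true Bellman solution `f` by at most `2·ε²`
at time `t−ε`. -/
theorem single_net_strategy_error {L A : Type} [Fintype L] [DecidableEq L]
    [Nonempty L] [Fintype A] (M : NCTMG L A) (t ε : ℝ) (hε0 : 0 < ε)
    (hε1 : ε ≤ 1)
    (x : L → ℝ) (hx : ∀ l, x l ∈ Set.Icc (0 : ℝ) 1)
    (f : L → ℝ → ℝ) (hf : M.SolvesBellman t ε x f)
    (hf01 : ∀ l, ∀ τ ∈ Set.Icc (t - ε) t, f l τ ∈ Set.Icc (0 : ℝ) 1)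
    (act : L → A) (p1 : L → ℝ → ℝ) (hp1 : M.IsSingleNet t ε x act p1)
    (g1 : L → ℝ → ℝ)
    (hg1t : ∀ l, g1 l t = x l)
    (hg101 : ∀ l, ∀ τ ∈ Set.Icc (t - ε) t, g1 l τ ∈ Set.Icc (0 : ℝ) 1)
    (hg1r : ∀ l, M.isReach l = true → ∀ τ ∈ Set.Icc (t - ε) t,
      HasDerivAt (g1 l) (-(∑ l', M.Q l (act l) l' * g1 l' τ)) τ)
    (hg1s : ∀ l, M.isReach l = false → ∀ τ ∈ Set.Icc (t - ε) t,
      HasDerivAt (g1 l)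
        (-((M.enabled l).inf' (M.enabled_nonempty l)
            (fun a => ∑ l', M.Q l a l' * g1 l' τ))) τ) :
    supNorm (fun l => g1 l (t - ε) - f l (t - ε)) ≤ 2 * ε ^ 2 := by
  obtain ⟨hact, hopt, -⟩ := hp1
  have hε : ε ∈ Set.Icc 0 ε := ⟨hε0.le, le_rfl⟩
  have hg : ∀ l, ∀ τ ∈ Set.Icc (t - ε) t,
      HasDerivAt (g1 l) (-M.fixedReachStep act l fun l' => g1 l' τ) τ := fun l τ hτ => by
    unfold NCTMG.fixedReachStep
    split_ifs with hl
    · exact hg1r l hl τ hτ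
    · exact hg1s l (by simpa using hl) τ hτ
  refine Finset.sup'_le _ _ fun l _ => ?_
  have hfl := M.isStepOperator_opt.abs_sub_euler_le hf01 hf.2 l hε
  have hgl := (M.isStepOperator_fixedReachStep hact).abs_sub_euler_le hg101 hg l hε
  simp only [hf.1] at hfl
  simp only [hg1t] at hgl
  rw [M.fixedReachStep_eq_opt (hopt l)] at hgl
  rw [abs_le] at *
  constructor <;> linarith
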